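/- Let g be analytic on 𝔻 with constants 0 < m ≤ |g'(z)| ≤ M for all z ∈ 𝔻. Then: (a) for every analytic f on 𝔻 with sup_{0≤r<1} ∫₀^{2π} |f(re^{iθ})| dθ < ∞ (i.e. f ∈ H^1), the function V_g f is bounded on 𝔻; (b) for every analytic f on 𝔻, if V_g f is bounded on 𝔻 then sup_{z∈𝔻}(1−|z|)|f(z)| < ∞. That is, H^1 ⊆ [V_g, H^∞] ⊆ A^{−1}. -/

import Mathlib

open Metric Real

/-- The generalized Volterra operator `(V_g f)(z) = ∫₀ᶻ f(ξ)g'(ξ)dξ = z·∫₀¹ f(sz)g'(sz) ds`. -/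
noncomputable def Vg (g f : ℂ → ℂ) (z : ℂ) : ℂ :=
  z * ∫ s in (0:ℝ)..1, f ((s : ℂ) * z) * deriv g ((s : ℂ) * z)

/-- `f` belongs to the Hardy space `H¹`: `sup_{0≤r<1} ∫₀^{2π} |f(r e^{iθ})| dθ < ∞`. -/
def memH1 (f : ℂ → ℂ) : Prop :=
  ∃ C : ℝ, ∀ r ∈ Set.Ico (0:ℝ) 1,
    (∫ θ in (0:ℝ)..(2 * π), ‖f ((r : ℂ) * Complex.exp ((θ : ℂ) * Complex.I))‖) ≤ C

/-- A function with continuous derivative `h` on `𝔻` satisfies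
`F z - F 0 = z * ∫₀¹ h(sz) ds`. -/
lemma mul_integral_deriv_segment_eq_sub {F h : ℂ → ℂ} (hh : ContinuousOn h (ball (0:ℂ) 1))
    (hF : ∀ z ∈ ball (0:ℂ) 1, HasDerivAt F (h z) z) {z : ℂ} (hz : z ∈ ball (0:ℂ) 1) :
    z * ∫ s in (0:ℝ)..1, h ((s : ℂ) * z) = F z - F 0 := by
  have hmem : ∀ s ∈ Set.uIcc (0:ℝ) 1, (s : ℂ) * z ∈ ball (0:ℂ) 1 := by
    intro s hs
    rw [Set.uIcc_of_le zero_le_one] at hs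
    rw [mem_ball_zero_iff] at hz ⊢
    rw [norm_mul, Complex.norm_real, Real.norm_of_nonneg hs.1]
    exact (mul_le_of_le_one_left (norm_nonneg z) hs.2).trans_lt hz
  have hder : ∀ s ∈ Set.uIcc (0:ℝ) 1,
      HasDerivAt (fun s : ℝ => F ((s : ℂ) * z)) (z * h ((s : ℂ) * z)) s := by
    intro s hs
    have hline : HasDerivAt (fun s : ℝ => (s : ℂ) * z) z s := by
      simpa using (Complex.ofRealCLM.hasDerivAt (x := s)).mul_const z
    rw [mul_comm z]
    exact (hF _ (hmem s hs)).comp s hline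
  have hint : IntervalIntegrable (fun s : ℝ => z * h ((s : ℂ) * z)) MeasureTheory.volume 0 1 :=
    (continuousOn_const.mul (hh.comp (by fun_prop) hmem)).intervalIntegrable
  rw [← intervalIntegral.integral_const_mul,
    intervalIntegral.integral_eq_sub_of_hasDerivAt hder hint]
  simp

/-- `V_g f` is the primitive of `f * g'` on `𝔻`. -/
lemma hasDerivAt_Vg {g f : ℂ → ℂ} (hg : DifferentiableOn ℂ g (ball (0:ℂ) 1))
    (hf : DifferentiableOn ℂ f (ball (0:ℂ) 1)) {z : ℂ} (hz : z ∈ ball (0:ℂ) 1) :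
    HasDerivAt (Vg g f) (f z * deriv g z) z := by
  have hh : DifferentiableOn ℂ (fun z => f z * deriv g z) (ball (0:ℂ) 1) :=
    hf.mul (hg.deriv isOpen_ball)
  obtain ⟨F, hF⟩ := hh.isExactOn_ball
  refine ((hF z hz).sub_const (F 0)).congr_of_eventuallyEq ?_
  filter_upwards [isOpen_ball.mem_nhds hz] with w hw
  exact mul_integral_deriv_segment_eq_sub hh.continuousOn hF hw

/-- The oscillation of a function on a circle is at most the integral of its derivative along the
circle. -/
lemma norm_sub_le_integral_norm_deriv_circleMap {F h : ℂ → ℂ} {c : ℂ} {r : ℝ} (hr : 0 ≤ r)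
    (hh : ContinuousOn h (sphere c r)) (hF : ∀ z ∈ sphere c r, HasDerivAt F (h z) z)
    {z w : ℂ} (hz : z ∈ sphere c r) (hw : w ∈ sphere c r) :
    ‖F z - F w‖ ≤ r * ∫ θ in (0:ℝ)..(2 * π), ‖h (circleMap c r θ)‖ := by
  have hmem : ∀ θ, circleMap c r θ ∈ sphere c r := circleMap_mem_sphere c hr
  have hcont : Continuous fun θ => h (circleMap c r θ) * (circleMap 0 r θ * Complex.I) :=
    (hh.comp_continuous (continuous_circleMap c r) hmem).mul
      ((continuous_circleMap 0 r).mul continuous_const)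
  rw [← abs_of_nonneg hr, ← image_circleMap_Ioc] at hz hw
  obtain ⟨β, hβ, rfl⟩ := hz
  obtain ⟨α, hα, rfl⟩ := hw
  rw [← intervalIntegral.integral_eq_sub_of_hasDerivAt
    (f := fun θ => F (circleMap c r θ))
    (fun θ _ => (hF _ (hmem θ)).comp θ (hasDerivAt_circleMap c r θ))
    (hcont.intervalIntegrable α β)]
  have hsub : Set.uIoc α β ⊆ Set.uIoc 0 (2 * π) := by
    rw [Set.uIoc_of_le two_pi_pos.le]
    exact Set.Ioc_subset_Ioc (le_min hα.1.le hβ.1.le) (max_le hα.2 hβ.2)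
  calc _ ≤ |∫ θ in α..β, ‖h (circleMap c r θ) * (circleMap 0 r θ * Complex.I)‖| :=
        intervalIntegral.norm_integral_le_abs_integral_norm
    _ ≤ |∫ θ in (0:ℝ)..(2 * π), ‖h (circleMap c r θ) * (circleMap 0 r θ * Complex.I)‖| :=
        intervalIntegral.abs_integral_mono_interval hsub
          (Filter.Eventually.of_forall fun _ => norm_nonneg _)
          (hcont.norm.intervalIntegrable _ _)
    _ = ∫ θ in (0:ℝ)..(2 * π), ‖h (circleMap c r θ) * (circleMap 0 r θ * Complex.I)‖ :=
        abs_of_nonneg <| intervalIntegral.integral_nonneg two_pi_pos.le fun _ _ => norm_nonneg _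
    _ = r * ∫ θ in (0:ℝ)..(2 * π), ‖h (circleMap c r θ)‖ := by
        rw [← intervalIntegral.integral_const_mul]
        simp [abs_of_nonneg hr, mul_comm]

/-- By the maximum principle, the oscillation bound on a circle also controls the difference
between the value on the circle and the value at the centre. -/
lemma norm_sub_center_le_integral_norm_deriv_circleMap {F h : ℂ → ℂ} {c : ℂ} {r : ℝ} (hr : 0 < r)
    (hh : ContinuousOn h (sphere c r)) (hF : ∀ z ∈ closedBall c r, HasDerivAt F (h z) z)
    {w : ℂ} (hw : w ∈ sphere c r) :
    ‖F c - F w‖ ≤ r * ∫ θ in (0:ℝ)..(2 * π), ‖h (circleMap c r θ)‖ := by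
  have hd : DifferentiableOn ℂ (fun z => F z - F w) (closure (ball c r)) := fun z hz =>
    ((hF z (closure_ball_subset_closedBall hz)).sub_const
      (F w)).differentiableAt.differentiableWithinAt
  refine Complex.norm_le_of_forall_mem_frontier_norm_le (f := fun z => F z - F w)
    isBounded_ball hd.diffContOnCl (fun z hz => ?_) (subset_closure (mem_ball_self hr))
  rw [frontier_ball c hr.ne'] at hz
  exact norm_sub_le_integral_norm_deriv_circleMap hr.le hh
    (fun z hz => hF z (sphere_subset_closedBall hz)) hz hw

lemma norm_Vg_le_of_memH1 {g f : ℂ → ℂ} (hg : DifferentiableOn ℂ g (ball (0:ℂ) 1))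
    (hf : DifferentiableOn ℂ f (ball (0:ℂ) 1)) {M : ℝ}
    (hM : ∀ z ∈ ball (0:ℂ) 1, ‖deriv g z‖ ≤ M) (hf1 : memH1 f) :
    ∃ C : ℝ, ∀ z ∈ ball (0:ℂ) 1, ‖Vg g f z‖ ≤ C := by
  obtain ⟨C, hC⟩ := hf1
  have hM0 : 0 ≤ M := (norm_nonneg _).trans (hM 0 (mem_ball_self one_pos))
  have hC0 : 0 ≤ C := (intervalIntegral.integral_nonneg two_pi_pos.le
    fun _ _ => norm_nonneg _).trans (hC 0 ⟨le_rfl, one_pos⟩)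
  refine ⟨M * C, fun z hz => ?_⟩
  have hV0 : Vg g f 0 = 0 := by simp [Vg]
  rcases eq_or_ne z 0 with rfl | hz0
  · rw [hV0, norm_zero]
    positivity
  have hr1 : ‖z‖ < 1 := mem_ball_zero_iff.mp hz
  have hball : closedBall (0:ℂ) ‖z‖ ⊆ ball 0 1 := closedBall_subset_ball hr1
  have hsphere : sphere (0:ℂ) ‖z‖ ⊆ ball 0 1 := sphere_subset_closedBall.trans hball
  have hmem : ∀ θ, circleMap 0 ‖z‖ θ ∈ sphere (0:ℂ) ‖z‖ :=
    circleMap_mem_sphere 0 (norm_nonneg z)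
  have hgc : ContinuousOn (deriv g) (sphere (0:ℂ) ‖z‖) :=
    (hg.deriv isOpen_ball).continuousOn.mono hsphere
  have hfc : ContinuousOn f (sphere (0:ℂ) ‖z‖) := hf.continuousOn.mono hsphere
  have hosc := norm_sub_center_le_integral_norm_deriv_circleMap (norm_pos_iff.mpr hz0)
    (hfc.mul hgc) (fun w hw => hasDerivAt_Vg hg hf (hball hw)) (mem_sphere_zero_iff_norm.mpr rfl)
  rw [hV0, zero_sub, norm_neg] at hosc
  calc ‖Vg g f z‖
      ≤ ‖z‖ * ∫ θ in (0:ℝ)..(2 * π),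
          ‖f (circleMap 0 ‖z‖ θ) * deriv g (circleMap 0 ‖z‖ θ)‖ := hosc
    _ ≤ ∫ θ in (0:ℝ)..(2 * π), ‖f (circleMap 0 ‖z‖ θ) * deriv g (circleMap 0 ‖z‖ θ)‖ :=
        mul_le_of_le_one_left
          (intervalIntegral.integral_nonneg two_pi_pos.le fun _ _ => norm_nonneg _) hr1.le
    _ ≤ ∫ θ in (0:ℝ)..(2 * π), M * ‖f (circleMap 0 ‖z‖ θ)‖ := by
        refine intervalIntegral.integral_mono_on two_pi_pos.le ?_ ?_ fun θ _ => ?_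
        · exact ((hfc.mul hgc).comp_continuous (continuous_circleMap 0 _)
            hmem).norm.intervalIntegrable _ _
        · exact (continuous_const.mul (hfc.comp_continuous (continuous_circleMap 0 _)
            hmem).norm).intervalIntegrable _ _
        · rw [norm_mul, mul_comm]
          exact mul_le_mul_of_nonneg_right (hM _ (hsphere (hmem θ))) (norm_nonneg _)
    _ = M * ∫ θ in (0:ℝ)..(2 * π), ‖f (circleMap 0 ‖z‖ θ)‖ :=
        intervalIntegral.integral_const_mul _ _
    _ ≤ M * C := by
        refine mul_le_mul_of_nonneg_left ?_ hM0
        simpa [circleMap] using hC ‖z‖ ⟨norm_nonneg z, hr1⟩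

lemma one_sub_norm_mul_norm_le_of_norm_Vg_le {g f : ℂ → ℂ}
    (hg : DifferentiableOn ℂ g (ball (0:ℂ) 1)) (hf : DifferentiableOn ℂ f (ball (0:ℂ) 1))
    {m C : ℝ} (hm : 0 < m) (hgm : ∀ z ∈ ball (0:ℂ) 1, m ≤ ‖deriv g z‖)
    (hC : ∀ z ∈ ball (0:ℂ) 1, ‖Vg g f z‖ ≤ C) {z : ℂ} (hz : z ∈ ball (0:ℂ) 1) :
    (1 - ‖z‖) * ‖f z‖ ≤ 2 * C / m := by
  have hz1 : ‖z‖ < 1 := mem_ball_zero_iff.mp hz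
  have hR : 0 < (1 - ‖z‖) / 2 := by linarith
  have hball : closedBall z ((1 - ‖z‖) / 2) ⊆ ball 0 1 :=
    closedBall_subset_ball' (by rw [dist_zero_right]; linarith)
  have hd : DifferentiableOn ℂ (Vg g f) (closure (ball z ((1 - ‖z‖) / 2))) := fun w hw =>
    (hasDerivAt_Vg hg hf
      (hball (closure_ball_subset_closedBall hw))).differentiableAt.differentiableWithinAt
  have hcauchy := Complex.norm_deriv_le_of_forall_mem_sphere_norm_le hR hd.diffContOnCl
    fun w hw => hC w (hball (sphere_subset_closedBall hw))
  rw [(hasDerivAt_Vg hg hf hz).deriv, norm_mul, le_div_iff₀ hR] at hcauchy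
  rw [le_div_iff₀ hm]
  have hlow : (1 - ‖z‖) * ‖f z‖ * m ≤ (1 - ‖z‖) * ‖f z‖ * ‖deriv g z‖ :=
    mul_le_mul_of_nonneg_left (hgm z hz) (mul_nonneg (by linarith) (norm_nonneg _))
  linarith

/-- For `g` analytic on `𝔻` with `0 < m ≤ |g'| ≤ M`:
(a) if `f ∈ H¹` then `V_g f` is bounded on `𝔻`;
(b) if `V_g f` is bounded on `𝔻` then `sup_{z∈𝔻}(1-|z|)|f(z)| < ∞`.
That is, `H¹ ⊆ [V_g, H^∞] ⊆ A^{-1}`. -/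
theorem H1_subset_optimalDomain_Hinfty_subset_Aminus1
    (g : ℂ → ℂ) (hg : DifferentiableOn ℂ g (ball (0:ℂ) 1))
    (m M : ℝ) (hm : 0 < m)
    (hg' : ∀ z ∈ ball (0:ℂ) 1, m ≤ ‖deriv g z‖ ∧ ‖deriv g z‖ ≤ M) :
    (∀ f : ℂ → ℂ, DifferentiableOn ℂ f (ball (0:ℂ) 1) → memH1 f →
      ∃ C : ℝ, ∀ z ∈ ball (0:ℂ) 1, ‖Vg g f z‖ ≤ C) ∧
    (∀ f : ℂ → ℂ, DifferentiableOn ℂ f (ball (0:ℂ) 1) →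
      (∃ C : ℝ, ∀ z ∈ ball (0:ℂ) 1, ‖Vg g f z‖ ≤ C) →
      ∃ C : ℝ, ∀ z ∈ ball (0:ℂ) 1, (1 - ‖z‖) * ‖f z‖ ≤ C) := by
  refine ⟨fun f hf hf1 => norm_Vg_le_of_memH1 hg hf (fun z hz => (hg' z hz).2) hf1, ?_⟩
  rintro f hf ⟨C, hC⟩
  exact ⟨2 * C / m, fun z hz =>
    one_sub_norm_mul_norm_le_of_norm_Vg_le hg hf hm (fun z hz => (hg' z hz).1) hC hz⟩
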